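/- arXiv:1006.1845 — 2 statements merged into one kernel-verified Lean document; each statement's English description precedes it below -/
import Mathlib

section
/- Let n ≥ 1 and θ ∈ ℝ. Every closed subspace H₀ of L²(ℝ^{2n+1}, λ; ℂ) satisfying Π^θ(φ)H₀ ⊆ H₀ for every compactly supported contactomorphism φ of (ℝ^{2n+1}, ker α₀) is either {0} or all of L²(ℝ^{2n+1}, λ; ℂ). (This is the case M = H_n, ξ = ker α₀ of the theorem that for every θ ∈ ℝ the representation Π^θ of the group of compactly supported contactomorphisms of a contact manifold on L²(M, μ) is irreducible.) -/
open MeasureTheory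

/-- `ℝ²ⁿ⁺¹ = ℝⁿ × ℝⁿ × ℝ`, identified with the Heisenberg group `H_n`. -/
abbrev H (n : ℕ) := EuclideanSpace ℝ (Fin n) × EuclideanSpace ℝ (Fin n) × ℝ

/-- The Heisenberg group product `(x,y,z)·(x',y',z') = (x+x', y+y', z+z'+⟨x,y'⟩)`. -/
noncomputable def hmul {n : ℕ} (p q : H n) : H n :=
  (p.1 + q.1, p.2.1 + q.2.1, p.2.2 + q.2.2 + ∑ i, p.1 i * q.2.1 i)

/-- The standard contact form `α₀ = dz - ∑ yⁱ dxⁱ`: at the point `p = (x,y,z)`,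
applied to a tangent vector `ζ = (u,v,w)` it gives `w - ⟨y,u⟩`. -/
noncomputable def alpha0 {n : ℕ} (p : H n) (ζ : H n) : ℝ :=
  ζ.2.2 - ∑ i, p.2.1 i * ζ.1 i

/-- A compactly supported contactomorphism of `(ℝ²ⁿ⁺¹, ker α₀)`: a `C^∞`
diffeomorphism whose support has compact closure and whose derivative preserves
the contact distribution `ker α₀`. -/
structure CSContactomorphism (n : ℕ) where
  toFun : H n → H n
  invFun : H n → H n
  left_inv : Function.LeftInverse invFun toFun
  right_inv : Function.RightInverse invFun toFun
  smooth : ContDiff ℝ (⊤ : ℕ∞) toFun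
  smooth_inv : ContDiff ℝ (⊤ : ℕ∞) invFun
  compactSupp : IsCompact (closure {p | toFun p ≠ p})
  contact : ∀ p ζ, alpha0 p ζ = 0 → alpha0 (toFun p) (fderiv ℝ toFun p ζ) = 0

/-- The Radon–Nikodym derivative `d(γ_*λ)/dλ` of the pushforward of Lebesgue
measure under `γ`, computed as `J(p) = |det D(γ⁻¹)(p)|`. -/
noncomputable def jac {n : ℕ} (γ : CSContactomorphism n) (p : H n) : ℝ :=
  |(fderiv ℝ γ.invFun p).det|

/-- The representation `Π^θ(γ)f(p) = f(γ⁻¹(p)) · J(p)^{1/2} · exp(iθ log J(p))`. -/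
noncomputable def PiTheta {n : ℕ} (θ : ℝ) (γ : CSContactomorphism n)
    (f : H n → ℂ) : H n → ℂ :=
  fun p => f (γ.invFun p) * (Real.sqrt (jac γ p) : ℂ) *
    Complex.exp (Complex.I * θ * (Real.log (jac γ p) : ℂ))

section Perturbation

open scoped ContDiff RealInnerProductSpace Topology
open Filter

variable {E : Type*} [NormedAddCommGroup E] [NormedSpace ℝ E] [CompleteSpace E]

/-- A smooth map whose derivative stays within `1/2` of the identity is a diffeomorphism. -/
theorem exists_smooth_inverse_of_fderiv_sub_id {u : E → E} (hu : ContDiff ℝ ∞ u)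
    (hb : ∀ w, ‖fderiv ℝ u w‖ ≤ 1 / 2) :
    ∃ G : E → E, Function.LeftInverse G (fun w => w + u w) ∧
      Function.RightInverse G (fun w => w + u w) ∧ ContDiff ℝ ∞ G := by
  have hdu : Differentiable ℝ u := hu.differentiable (by simp)
  have hlip : LipschitzWith (1 / 2) u :=
    lipschitzWith_of_nnnorm_fderiv_le hdu fun x => by
      rw [← NNReal.coe_le_coe]; simpa using hb x
  have happ : ApproximatesLinearOn (fun w => w + u w)
      ((ContinuousLinearEquiv.refl ℝ E : E ≃L[ℝ] E) : E →L[ℝ] E) Set.univ (1 / 2) := by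
    intro x _ y _
    have := hlip.norm_sub_le x y
    simpa [add_sub_add_comm] using this
  have hc : Subsingleton E ∨
      (1 / 2 : NNReal) < ‖((ContinuousLinearEquiv.refl ℝ E).symm : E →L[ℝ] E)‖₊⁻¹ := by
    rcases subsingleton_or_nontrivial E with h | h
    · exact Or.inl h
    · right
      have : ‖((ContinuousLinearEquiv.refl ℝ E).symm : E →L[ℝ] E)‖₊ = 1 := by
        ext; exact ContinuousLinearMap.norm_id
      rw [this, inv_one]
      exact NNReal.half_lt_self one_ne_zero
  let e : E ≃ₜ E := happ.toHomeomorph _ hc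
  have he : ⇑e = fun w => w + u w := rfl
  have hlt : ∀ w, ‖-fderiv ℝ u w‖ < 1 := fun w => by
    rw [norm_neg]; exact (hb w).trans_lt (by norm_num)
  let f' : E → E ≃L[ℝ] E := fun w =>
    ContinuousLinearEquiv.unitsEquiv ℝ E (Units.oneSub (-fderiv ℝ u w) (hlt w))
  refine ⟨e.symm, e.symm_apply_apply, e.apply_symm_apply,
    e.contDiff_symm (f₀' := f') (fun a => ?_) ?_⟩
  · rw [he]
    convert! (hasFDerivAt_id a).add (hdu a).hasFDerivAt using 1
    ext v
    simp [f']
  · rw [he]; exact contDiff_id.add hu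

variable {A F : Type*} [NormedAddCommGroup A] [NormedSpace ℝ A]
  [NormedAddCommGroup F] [NormedSpace ℝ F]

omit [CompleteSpace E] in
theorem fderiv_slice {f : A × E → F} {a : A} {w : E} (hf : DifferentiableAt ℝ f (a, w)) :
    fderiv ℝ (fun w' => f (a, w')) w =
      (fderiv ℝ f (a, w)).comp (ContinuousLinearMap.inr ℝ A E) :=
  (hf.hasFDerivAt.comp w (hasFDerivAt_prodMk_right a w)).fderiv

omit [CompleteSpace E] in
/-- A family of maps which vanishes at the parameter `0` and outside a fixed compact set has
uniformly small derivatives for small parameters. -/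
theorem eventually_norm_fderiv_le {f : A × E → F} {K : Set E} (hK : IsCompact K)
    (hf : ∀ w, ContDiffAt ℝ ∞ f (0, w)) (h0 : ∀ w, f (0, w) = 0)
    (hout : ∀ a, ∀ w ∉ K, f (a, w) = 0) :
    ∀ᶠ a in 𝓝 (0 : A), ∀ w, ‖fderiv ℝ (fun w' => f (a, w')) w‖ ≤ 1 / 2 := by
  have key : ∀ᶠ a in 𝓝 (0 : A), ∀ w ∈ K, ‖fderiv ℝ (fun w' => f (a, w')) w‖ ≤ 1 / 2 := by
    refine hK.eventually_forall_of_forall_eventually fun w _ => ?_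
    have h1 : ContDiffAt ℝ 1 f (0, w) := (hf w).of_le (by norm_cast)
    have hd : ∀ᶠ z in 𝓝 ((0 : A), w), DifferentiableAt ℝ f z := by
      filter_upwards [h1.eventually (by simp)] with z hz using hz.differentiableAt (by simp)
    have hc : ContinuousAt (fun z : A × E =>
        ‖(fderiv ℝ f z).comp (ContinuousLinearMap.inr ℝ A E)‖) (0, w) :=
      ((h1.fderiv_right (m := 0) (by simp)).continuousAt.clm_comp continuousAt_const).norm
    have hz : ‖(fderiv ℝ f (0, w)).comp (ContinuousLinearMap.inr ℝ A E)‖ < 1 / 2 := by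
      rw [← fderiv_slice hd.self_of_nhds]
      simp [h0]
    filter_upwards [hd, hc.eventually_lt continuousAt_const hz] with z hz1 hz2
    rw [fderiv_slice (a := z.1) (w := z.2) hz1]
    exact hz2.le
  filter_upwards [key] with a ha w
  by_cases hw : w ∈ K
  · exact ha w hw
  · have : (fun w' => f (a, w')) =ᶠ[𝓝 w] fun _ => 0 := by
      filter_upwards [hK.isClosed.isOpen_compl.mem_nhds hw] with w' hw' using hout a w' hw'
    rw [this.fderiv_eq]
    simp

end Perturbation

section GeneratingFunction

open scoped ContDiff RealInnerProductSpace Topology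
open Filter

variable {n : ℕ}

theorem alpha0_eq_inner (p ζ : H n) : alpha0 p ζ = ζ.2.2 - ⟪p.2.1, ζ.1⟫ := by
  simp [alpha0, PiLp.inner_apply, mul_comm]

/-- The partial gradient in the `x` variables. -/
noncomputable def gradX (S : H n → ℝ) (w : H n) : EuclideanSpace ℝ (Fin n) :=
  (InnerProductSpace.toDual ℝ _).symm
    ((fderiv ℝ S w).comp (ContinuousLinearMap.inl ℝ _ (EuclideanSpace ℝ (Fin n) × ℝ)))

/-- The partial gradient in the `y` variables. -/
noncomputable def gradY (S : H n → ℝ) (w : H n) : EuclideanSpace ℝ (Fin n) :=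
  (InnerProductSpace.toDual ℝ _).symm
    ((fderiv ℝ S w).comp ((ContinuousLinearMap.inr ℝ (EuclideanSpace ℝ (Fin n)) _).comp
      (ContinuousLinearMap.inl ℝ _ ℝ)))

/-- The partial derivative in the `z` variable. -/
noncomputable def derivZ (S : H n → ℝ) (w : H n) : ℝ := fderiv ℝ S w (0, 0, 1)

theorem inner_gradX (S : H n → ℝ) (w : H n) (v : EuclideanSpace ℝ (Fin n)) :
    ⟪gradX S w, v⟫ = fderiv ℝ S w (v, 0, 0) := by
  simp [gradX, InnerProductSpace.toDual_symm_apply, ← Prod.mk_zero_zero]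

theorem inner_gradY (S : H n → ℝ) (w : H n) (v : EuclideanSpace ℝ (Fin n)) :
    ⟪gradY S w, v⟫ = fderiv ℝ S w (0, v, 0) := by
  simp [gradY, InnerProductSpace.toDual_symm_apply]

theorem fderiv_apply_eq_partials (S : H n → ℝ) (w η : H n) :
    fderiv ℝ S w η = ⟪gradX S w, η.1⟫ + ⟪gradY S w, η.2.1⟫ + derivZ S w * η.2.2 := by
  have h : η = (η.1, 0, 0) + (0, η.2.1, 0) + η.2.2 • ((0, 0, 1) : H n) := by
    ext <;> simp
  rw [inner_gradX, inner_gradY, derivZ]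
  conv_lhs => rw [h]
  simp only [map_add, map_smul, smul_eq_mul]
  ring

/-- The displacement of the source map `(x, Y, z) ↦ (x, (Y - ∂ₓS) / (1 + ∂_z S), z)` of the
contactomorphism generated by `S`. -/
noncomputable def sourceDisp (S : H n → ℝ) (w : H n) : H n :=
  (0, (1 + derivZ S w)⁻¹ • (w.2.1 - gradX S w) - w.2.1, 0)

/-- The displacement of the target map `(x, Y, z) ↦ (x - ∂_Y S, Y, z + S - ⟨Y, ∂_Y S⟩)` of the
contactomorphism generated by `S`. -/
noncomputable def targetDisp (S : H n → ℝ) (w : H n) : H n :=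
  (-gradY S w, 0, S w - ⟪w.2.1, gradY S w⟫)

variable {S : H n → ℝ}

theorem contDiff_gradX (hS : ContDiff ℝ ∞ S) : ContDiff ℝ ∞ (gradX S) :=
  (LinearIsometryEquiv.contDiff _).comp
    ((hS.fderiv_right (m := ∞) (by simp)).clm_comp contDiff_const)

theorem contDiff_gradY (hS : ContDiff ℝ ∞ S) : ContDiff ℝ ∞ (gradY S) :=
  (LinearIsometryEquiv.contDiff _).comp
    ((hS.fderiv_right (m := ∞) (by simp)).clm_comp contDiff_const)

theorem contDiff_derivZ (hS : ContDiff ℝ ∞ S) : ContDiff ℝ ∞ (derivZ S) :=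
  (hS.fderiv_right (m := ∞) (by simp)).clm_apply contDiff_const

theorem contDiff_targetDisp (hS : ContDiff ℝ ∞ S) : ContDiff ℝ ∞ (targetDisp S) := by
  have h := contDiff_gradY hS
  exact h.neg.prodMk (contDiff_const.prodMk
    (hS.sub ((contDiff_fst.comp contDiff_snd).inner ℝ h)))

theorem contDiff_sourceDisp (hS : ContDiff ℝ ∞ S) (hz : ∀ w, 1 + derivZ S w ≠ 0) :
    ContDiff ℝ ∞ (sourceDisp S) := by
  have hY : ContDiff ℝ ∞ (fun w : H n => w.2.1) := contDiff_fst.comp contDiff_snd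
  exact contDiff_const.prodMk ((((((contDiff_const.add (contDiff_derivZ hS)).inv hz).smul
    (hY.sub (contDiff_gradX hS))).sub hY)).prodMk contDiff_const)

theorem alpha0_target_eq (hS : ContDiff ℝ ∞ S) {w : H n} (hz : 1 + derivZ S w ≠ 0)
    {P' Q' : H n →L[ℝ] H n}
    (hP : HasFDerivAt (fun w => w + sourceDisp S w) P' w)
    (hQ : HasFDerivAt (fun w => w + targetDisp S w) Q' w) (η : H n) :
    alpha0 (w + targetDisp S w) (Q' η) =
      (1 + derivZ S w) * alpha0 (w + sourceDisp S w) (P' η) := by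
  have hgY : HasFDerivAt (gradY S) (fderiv ℝ (gradY S) w) w :=
    ((contDiff_gradY hS).differentiable (by simp) w).hasFDerivAt
  have hdS : HasFDerivAt S (fderiv ℝ S w) w := (hS.differentiable (by simp) w).hasFDerivAt
  have hP1 : (P' η).1 = η.1 := by
    have h1 : HasFDerivAt (fun w : H n => w.1) ((ContinuousLinearMap.fst ℝ _ _).comp P') w := by
      simpa [sourceDisp] using hP.fst
    have := h1.unique hasFDerivAt_fst
    simpa using congrArg (fun L => L η) this
  have hP2 : (P' η).2.2 = η.2.2 := by
    have h1 : HasFDerivAt (fun w : H n => w.2.2) ((ContinuousLinearMap.snd ℝ _ _).comp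
        ((ContinuousLinearMap.snd ℝ _ _).comp P')) w := by
      simpa [sourceDisp] using hP.snd.snd
    have := h1.unique (hasFDerivAt_snd (p := w)).snd
    simpa using congrArg (fun L => L η) this
  have hQ1 : (Q' η).1 = η.1 - fderiv ℝ (gradY S) w η := by
    have h1 : HasFDerivAt (fun w : H n => w.1 - gradY S w)
        ((ContinuousLinearMap.fst ℝ _ _).comp Q') w := by
      simpa [targetDisp, sub_eq_add_neg] using hQ.fst
    have := h1.unique (hasFDerivAt_fst.sub hgY)
    simpa using congrArg (fun L => L η) this
  have hQ2 : (Q' η).2.2 = η.2.2 + fderiv ℝ S w η -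
      (⟪w.2.1, fderiv ℝ (gradY S) w η⟫ + ⟪η.2.1, gradY S w⟫) := by
    have h1 : HasFDerivAt (fun w : H n => w.2.2 + (S w - ⟪w.2.1, gradY S w⟫))
        ((ContinuousLinearMap.snd ℝ _ _).comp ((ContinuousLinearMap.snd ℝ _ _).comp Q')) w := by
      simpa [targetDisp] using hQ.snd.snd
    have hw : HasFDerivAt (fun w : H n => w.2.1) ((ContinuousLinearMap.fst ℝ _ _).comp
      (ContinuousLinearMap.snd ℝ _ _)) w := (hasFDerivAt_snd (p := w)).fst
    have hw2 : HasFDerivAt (fun w : H n => w.2.2) ((ContinuousLinearMap.snd ℝ _ _).comp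
      (ContinuousLinearMap.snd ℝ _ _)) w := (hasFDerivAt_snd (p := w)).snd
    have := h1.unique (hw2.add (hdS.sub (hw.inner ℝ hgY)))
    have := congrArg (fun L => L η) this
    simp [fderivInnerCLM_apply] at this
    rw [this]; ring
  rw [alpha0_eq_inner, alpha0_eq_inner, hP1, hP2, hQ1, hQ2, fderiv_apply_eq_partials S w η]
  simp only [targetDisp, sourceDisp, Prod.snd_add, Prod.fst_add, add_zero, add_sub_cancel,
    real_inner_smul_left, inner_sub_right, inner_sub_left]
  rw [real_inner_comm (gradY S w) η.2.1]
  field_simp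
  ring

theorem gradX_eq_zero {w : H n} (h : S =ᶠ[𝓝 w] 0) : gradX S w = 0 := by
  simp [gradX, h.fderiv_eq]

theorem gradY_eq_zero {w : H n} (h : S =ᶠ[𝓝 w] 0) : gradY S w = 0 := by
  simp [gradY, h.fderiv_eq]

theorem derivZ_eq_zero {w : H n} (h : S =ᶠ[𝓝 w] 0) : derivZ S w = 0 := by
  simp [derivZ, h.fderiv_eq]

theorem sourceDisp_eq_zero {w : H n} (h : S =ᶠ[𝓝 w] 0) : sourceDisp S w = 0 := by
  simp [sourceDisp, gradX_eq_zero h, derivZ_eq_zero h]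

theorem targetDisp_eq_zero {w : H n} (h : S =ᶠ[𝓝 w] 0) : targetDisp S w = 0 := by
  simp [targetDisp, gradY_eq_zero h, h.self_of_nhds]

/-- A sufficiently small compactly supported generating function determines a compactly supported
contactomorphism. -/
theorem exists_contactomorphism_of_generating (hS : ContDiff ℝ ∞ S) (hc : HasCompactSupport S)
    (hz : ∀ w, |derivZ S w| ≤ 1 / 2)
    (hP : ∀ w, ‖fderiv ℝ (sourceDisp S) w‖ ≤ 1 / 2)
    (hQ : ∀ w, ‖fderiv ℝ (targetDisp S) w‖ ≤ 1 / 2) :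
    ∃ φ : CSContactomorphism n, ∀ w, φ.toFun (w + sourceDisp S w) = w + targetDisp S w := by
  have hz' : ∀ w, 1 + derivZ S w ≠ 0 := fun w => by
    have := (abs_le.1 (hz w)).1
    intro h; linarith
  have hsP := contDiff_sourceDisp hS hz'
  have hsQ := contDiff_targetDisp hS
  obtain ⟨GP, hGPl, hGPr, hGP⟩ := exists_smooth_inverse_of_fderiv_sub_id hsP hP
  obtain ⟨GQ, hGQl, hGQr, hGQ⟩ := exists_smooth_inverse_of_fderiv_sub_id hsQ hQ
  have hsP' : ContDiff ℝ ∞ (fun w => w + sourceDisp S w) := contDiff_id.add hsP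
  have hsQ' : ContDiff ℝ ∞ (fun w => w + targetDisp S w) := contDiff_id.add hsQ
  refine ⟨⟨fun p => GP p + targetDisp S (GP p), fun p => GQ p + sourceDisp S (GQ p),
    fun p => ?_, fun p => ?_, hsQ'.comp hGP, hsP'.comp hGQ, ?_, fun p ζ hζ => ?_⟩, fun w => ?_⟩
  · have h1 := hGQl (GP p)
    have h2 := hGPr p
    simp only at h1 h2 ⊢
    rw [h1, h2]
  · have h1 := hGPl (GQ p)
    have h2 := hGQr p
    simp only at h1 h2 ⊢
    rw [h1, h2]
  · have hK : IsCompact ((fun w => w + sourceDisp S w) '' tsupport S) :=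
      hc.isCompact.image hsP'.continuous
    refine hK.of_isClosed_subset isClosed_closure (closure_minimal ?_ hK.isClosed)
    intro p hp
    refine ⟨GP p, ?_, hGPr p⟩
    by_contra hn
    have h0 := notMem_tsupport_iff_eventuallyEq.1 hn
    have h2 := hGPr p
    have h3 := targetDisp_eq_zero h0
    simp only [sourceDisp_eq_zero h0, add_zero] at h2
    rw [h2] at h3
    exact hp (by simp [h2, h3])
  · have h1 := (hsP'.differentiable (by simp) (GP p)).hasFDerivAt
    have h2 := (hsQ'.differentiable (by simp) (GP p)).hasFDerivAt
    have h3 := (hGP.differentiable (by simp) p).hasFDerivAt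
    have h4 := h2.comp p h3
    have h5 : (fderiv ℝ (fun w => w + sourceDisp S w) (GP p)) (fderiv ℝ GP p ζ) = ζ := by
      have h6 : HasFDerivAt id _ p := (h1.comp p h3).congr_of_eventuallyEq
        (Eventually.of_forall fun q => (hGPr q).symm)
      have := h6.unique (hasFDerivAt_id p)
      simpa using congrArg (fun L => L ζ) this
    have h7 := alpha0_target_eq hS (hz' _) h1 h2 (fderiv ℝ GP p ζ)
    have h8 := hGPr p
    simp only at h8
    rw [h5, h8, hζ, mul_zero] at h7
    have h9 : fderiv ℝ (fun p => GP p + targetDisp S (GP p)) p = _ := h4.fderiv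
    rw [h9]
    exact h7
  · have h1 := hGPl w
    simp only at h1 ⊢
    rw [h1]

end GeneratingFunction

section Family

open scoped ContDiff RealInnerProductSpace Topology
open Filter

variable {n : ℕ} {A : Type*} [NormedAddCommGroup A] [NormedSpace ℝ A]

theorem contDiff_fderiv_slice {F : A × H n → ℝ} (hF : ContDiff ℝ ∞ F) :
    ContDiff ℝ ∞ (fun p : A × H n => fderiv ℝ (fun w' => F (p.1, w')) p.2) := by
  refine ContDiff.fderiv (m := ∞) (n := ∞) (f := fun (p : A × H n) (w' : H n) => F (p.1, w'))
    ?_ contDiff_snd (by simp)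
  exact hF.comp ((contDiff_fst.comp contDiff_fst).prodMk contDiff_snd)

theorem eventually_exists_contactomorphism {F : A × H n → ℝ} (hF : ContDiff ℝ ∞ F)
    {K : Set (H n)} (hK : IsCompact K) (hout : ∀ a, ∀ w ∉ K, F (a, w) = 0)
    (h0 : ∀ w, F (0, w) = 0) :
    ∀ᶠ a in 𝓝 (0 : A), ∃ φ : CSContactomorphism n, ∀ w,
      φ.toFun (w + sourceDisp (fun w' => F (a, w')) w) =
        w + targetDisp (fun w' => F (a, w')) w := by
  have hd := contDiff_fderiv_slice hF
  have hgx : ContDiff ℝ ∞ (fun p : A × H n => gradX (fun w' => F (p.1, w')) p.2) :=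
    (LinearIsometryEquiv.contDiff _).comp (hd.clm_comp contDiff_const)
  have hgy : ContDiff ℝ ∞ (fun p : A × H n => gradY (fun w' => F (p.1, w')) p.2) :=
    (LinearIsometryEquiv.contDiff _).comp (hd.clm_comp contDiff_const)
  have hgz : ContDiff ℝ ∞ (fun p : A × H n => derivZ (fun w' => F (p.1, w')) p.2) :=
    hd.clm_apply contDiff_const
  have hY : ContDiff ℝ ∞ (fun p : A × H n => p.2.2.1) :=
    contDiff_fst.comp (contDiff_snd.comp contDiff_snd)
  have hnear : ∀ a, ∀ w ∉ K, (fun w' => F (a, w')) =ᶠ[𝓝 w] 0 := fun a w hw => by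
    filter_upwards [hK.isClosed.isOpen_compl.mem_nhds hw] with w' hw' using hout a w' hw'
  have hzero : ∀ w, (fun w' => F (0, w')) =ᶠ[𝓝 w] 0 := fun w =>
    Eventually.of_forall fun w' => h0 w'
  have e1 := eventually_norm_fderiv_le hK (f := F) (fun w => hF.contDiffAt) h0 hout
  have e2 := eventually_norm_fderiv_le hK
    (f := fun p : A × H n => sourceDisp (fun w' => F (p.1, w')) p.2) (fun w => by
      have hne : 1 + derivZ (fun w' => F (0, w')) w ≠ 0 := by
        rw [derivZ_eq_zero (hzero w)]; norm_num
      exact contDiffAt_const.prodMk ((((((contDiffAt_const.add hgz.contDiffAt).inv hne).smul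
        (hY.sub hgx).contDiffAt)).sub hY.contDiffAt).prodMk contDiffAt_const))
    (fun w => sourceDisp_eq_zero (hzero w)) (fun a w hw => sourceDisp_eq_zero (hnear a w hw))
  have e3 := eventually_norm_fderiv_le hK
    (f := fun p : A × H n => targetDisp (fun w' => F (p.1, w')) p.2) (fun w =>
      (hgy.neg.prodMk (contDiff_const.prodMk (hF.sub (hY.inner ℝ hgy)))).contDiffAt)
    (fun w => targetDisp_eq_zero (hzero w)) (fun a w hw => targetDisp_eq_zero (hnear a w hw))
  filter_upwards [e1, e2, e3] with a h1 h2 h3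
  refine exists_contactomorphism_of_generating
    (hF.comp (contDiff_const.prodMk contDiff_id)) (HasCompactSupport.intro hK (hout a))
    (fun w => ?_) h2 h3
  have := (fderiv ℝ (fun w' => F (a, w')) w).le_opNorm (0, 0, 1)
  have hn : ‖((0, 0, 1) : H n)‖ = 1 := by simp [Prod.norm_def]
  rw [hn, mul_one] at this
  exact this.trans (h1 w)

/-- The affine contact map `(x, y, z) ↦ (x + u, (1 + e) y + v, (1 + e) z + ⟨v, x⟩ + c)`. -/
noncomputable def affineContact (u v : EuclideanSpace ℝ (Fin n)) (c e : ℝ) (p : H n) : H n :=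
  (p.1 + u, (1 + e) • p.2.1 + v, (1 + e) * p.2.2 + ⟪v, p.1⟫ + c)

/-- The affine generating function of `affineContact u v c e`. -/
noncomputable def affineGen (a w : H n) (e : ℝ) : ℝ :=
  a.2.2 - ⟪a.1, w.2.1⟫ + ⟪a.2.1, w.1⟫ + e * w.2.2

/-- The derivative of `affineGen a · e`. -/
noncomputable def affineGenDeriv (a : H n) (e : ℝ) : H n →L[ℝ] ℝ :=
  -((innerSL ℝ a.1).comp ((ContinuousLinearMap.fst ℝ _ ℝ).comp
      (ContinuousLinearMap.snd ℝ _ _))) +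
    (innerSL ℝ a.2.1).comp (ContinuousLinearMap.fst ℝ _ _) +
    e • ((ContinuousLinearMap.snd ℝ _ _).comp (ContinuousLinearMap.snd ℝ _ _))

theorem hasFDerivAt_affineGen (a w : H n) (e : ℝ) :
    HasFDerivAt (fun w' => affineGen a w' e) (affineGenDeriv a e) w := by
  have h : (fun w' => affineGen a w' e) = fun w' => a.2.2 + affineGenDeriv a e w' := by
    ext w'
    simp [affineGen, affineGenDeriv]
    ring
  rw [h]
  exact (affineGenDeriv a e).hasFDerivAt.const_add a.2.2

theorem sourceDisp_of_eventuallyEq_affineGen {S : H n → ℝ} {a w : H n} {e : ℝ}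
    (h : S =ᶠ[𝓝 w] fun w' => affineGen a w' e) :
    sourceDisp S w = (0, (1 + e)⁻¹ • (w.2.1 - a.2.1) - w.2.1, 0) := by
  have hd := h.fderiv_eq.trans (hasFDerivAt_affineGen a w e).fderiv
  have hx : gradX S w = a.2.1 := ext_inner_right ℝ fun v => by
    rw [inner_gradX, hd]; simp [affineGenDeriv]
  have hz : derivZ S w = e := by rw [derivZ, hd]; simp [affineGenDeriv]
  rw [sourceDisp, hx, hz]

theorem targetDisp_of_eventuallyEq_affineGen {S : H n → ℝ} {a w : H n} {e : ℝ}
    (h : S =ᶠ[𝓝 w] fun w' => affineGen a w' e) :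
    targetDisp S w = (a.1, 0, a.2.2 + ⟪a.2.1, w.1⟫ + e * w.2.2) := by
  have hd := h.fderiv_eq.trans (hasFDerivAt_affineGen a w e).fderiv
  have hy : gradY S w = -a.1 := ext_inner_right ℝ fun v => by
    rw [inner_gradY, hd]; simp [affineGenDeriv]
  rw [targetDisp, hy, h.self_of_nhds]
  simp only [affineGen]
  rw [inner_neg_right, neg_neg, real_inner_comm]
  ext1
  · rfl
  · ext1
    · rfl
    · simp only; ring

/-- Near the origin, every affine contact map close to the identity agrees with a compactly
supported contactomorphism. -/
theorem exists_contactomorphism_eq_affineContact (n : ℕ) :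
    ∃ r > 0, ∀ (u v : EuclideanSpace ℝ (Fin n)) (c e : ℝ), ‖u‖ < r → ‖v‖ < r → |c| < r →
      |e| < r → ∃ φ : CSContactomorphism n, ∀ p : H n, ‖p‖ < r →
        φ.toFun p = affineContact u v c e p := by
  let χ : ContDiffBump (0 : H n) := ⟨2, 3, by norm_num, by norm_num⟩
  let F : (H n × ℝ) × H n → ℝ := fun q => χ q.2 * affineGen q.1.1 q.2 q.1.2
  have hF : ContDiff ℝ ∞ F := by
    refine (χ.contDiff.comp contDiff_snd).mul ?_
    have h1 : ContDiff ℝ ∞ (fun q : (H n × ℝ) × H n => q.1.1) := contDiff_fst.comp contDiff_fst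
    have h2 : ContDiff ℝ ∞ (fun q : (H n × ℝ) × H n => q.1.2) := contDiff_snd.comp contDiff_fst
    have h3 : ContDiff ℝ ∞ (fun q : (H n × ℝ) × H n => q.2) := contDiff_snd
    exact (((contDiff_snd.comp (contDiff_snd.comp h1)).sub ((contDiff_fst.comp h1).inner ℝ
      (contDiff_fst.comp (contDiff_snd.comp h3)))).add
      ((contDiff_fst.comp (contDiff_snd.comp h1)).inner ℝ (contDiff_fst.comp h3))).add
      (h2.mul (contDiff_snd.comp (contDiff_snd.comp h3)))
  have hev := eventually_exists_contactomorphism hF (isCompact_closedBall (0 : H n) 3)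
    (fun a w hw => by
      have : χ w = 0 := χ.zero_of_le_dist (by
        simpa using (not_le.1 (fun h => hw (Metric.mem_closedBall.2 h))).le)
      simp [F, this])
    (fun w => by simp [F, affineGen])
  obtain ⟨δ, hδ, hball⟩ := Metric.eventually_nhds_iff.1 hev
  refine ⟨min δ (1 / 2), by positivity, fun u v c e hu hv hc he => ?_⟩
  have hdist : dist (((u, v, c), e) : H n × ℝ) 0 < δ := by
    rw [dist_zero_right]
    simp only [Prod.norm_def, Real.norm_eq_abs, sup_lt_iff]
    exact ⟨⟨hu.trans_le (min_le_left _ _), hv.trans_le (min_le_left _ _),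
      hc.trans_le (min_le_left _ _)⟩, he.trans_le (min_le_left _ _)⟩
  obtain ⟨φ, hφ⟩ := hball hdist
  refine ⟨φ, fun p hp => ?_⟩
  have hv2 := hv.trans_le (min_le_right _ _)
  have he2 := he.trans_le (min_le_right _ _)
  have hp2 := hp.trans_le (min_le_right _ _)
  have he3 : (1 + e) ≠ 0 := by
    have := (abs_lt.1 he2).1
    intro h; linarith
  let w : H n := (p.1, (1 + e) • p.2.1 + v, p.2.2)
  have hp21 : ‖p.2.1‖ < 1 / 2 := ((norm_fst_le p.2).trans (norm_snd_le p)).trans_lt hp2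
  have hwn : ‖w‖ < 2 := by
    simp only [w, Prod.norm_def, sup_lt_iff]
    refine ⟨by linarith [norm_fst_le p], ?_, by
      linarith [(norm_snd_le p.2).trans (norm_snd_le p)]⟩
    have h1 := norm_add_le ((1 + e) • p.2.1) v
    rw [norm_smul, Real.norm_eq_abs] at h1
    have h2 : |1 + e| ≤ 3 / 2 := by
      rw [abs_le]; constructor <;> linarith [(abs_lt.1 he2).1, (abs_lt.1 he2).2]
    nlinarith [norm_nonneg p.2.1, abs_nonneg (1 + e)]
  have hnear : (fun w' => F (((u, v, c), e), w')) =ᶠ[𝓝 w]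
      fun w' => affineGen (u, v, c) w' e := by
    have : ∀ᶠ w' in 𝓝 w, ‖w'‖ < 2 :=
      continuous_norm.continuousAt.eventually_lt continuousAt_const hwn
    filter_upwards [this] with w' hw'
    have : χ w' = 1 := χ.one_of_mem_closedBall (by simpa [χ] using hw'.le)
    simp [F, this]
  have h := hφ w
  rw [sourceDisp_of_eventuallyEq_affineGen hnear, targetDisp_of_eventuallyEq_affineGen hnear] at h
  have hs : w + ((0, (1 + e)⁻¹ • (w.2.1 - v) - w.2.1, 0) : H n) = p := by
    simp only [w, add_sub_cancel_right, smul_smul, inv_mul_cancel₀ he3, one_smul]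
    ext1
    · simp
    · ext1 <;> simp
  rw [hs] at h
  rw [h]
  simp only [w, affineContact]
  ext1
  · rfl
  · ext1
    · simp
    · simp only [Prod.snd_add]; ring

end Family

section Jacobian

open scoped ContDiff RealInnerProductSpace Topology
open Filter

variable {n : ℕ}

instance isAddHaarMeasure_volume_H : (volume : Measure (H n)).IsAddHaarMeasure :=
  have : (volume : Measure (EuclideanSpace ℝ (Fin n) × ℝ)).IsAddHaarMeasure :=
    Measure.prod.instIsAddHaarMeasure volume volume
  Measure.prod.instIsAddHaarMeasure volume volume

namespace CSContactomorphism

theorem fderiv_comp_fderiv_inv (φ : CSContactomorphism n) (p : H n) :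
    (fderiv ℝ φ.toFun (φ.invFun p)).comp (fderiv ℝ φ.invFun p) = .id ℝ (H n) := by
  have h1 := (φ.smooth.differentiable (by simp) (φ.invFun p)).hasFDerivAt.comp p
    (φ.smooth_inv.differentiable (by simp) p).hasFDerivAt
  have h2 : φ.toFun ∘ φ.invFun = id := funext φ.right_inv
  rw [h2] at h1
  exact h1.unique (hasFDerivAt_id p)

theorem det_mul_det_inv (φ : CSContactomorphism n) (p : H n) :
    (fderiv ℝ φ.toFun (φ.invFun p)).det * (fderiv ℝ φ.invFun p).det = 1 := by
  have h := congrArg (fun L : H n →L[ℝ] H n => LinearMap.det (L : H n →ₗ[ℝ] H n))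
    (φ.fderiv_comp_fderiv_inv p)
  simpa [ContinuousLinearMap.det] using h

theorem jac_pos (φ : CSContactomorphism n) (p : H n) : 0 < jac φ p :=
  abs_pos.2 (right_ne_zero_of_mul (φ.det_mul_det_inv p ▸ one_ne_zero))

theorem continuous_jac (φ : CSContactomorphism n) : Continuous (jac φ) :=
  (ContinuousLinearMap.continuous_det.comp (φ.smooth_inv.continuous_fderiv (by simp))).abs

theorem image_invFun_univ (φ : CSContactomorphism n) : φ.invFun '' Set.univ = Set.univ :=
  Set.image_univ_of_surjective φ.left_inv.surjective

theorem integrable_jac_smul_comp (φ : CSContactomorphism n) {g : H n → ℝ} (hg : Integrable g) :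
    Integrable (fun p => jac φ p • g (φ.invFun p)) := by
  have h := integrableOn_image_iff_integrableOn_abs_det_fderiv_smul volume MeasurableSet.univ
    (fun x _ => (φ.smooth_inv.differentiable (by simp) x).hasFDerivAt.hasFDerivWithinAt)
    φ.right_inv.injective.injOn g
  rw [φ.image_invFun_univ, integrableOn_univ, integrableOn_univ] at h
  exact h.1 hg

end CSContactomorphism

/-- The scalar multiplier `J^{1/2 + iθ}` of `Π^θ(φ)`. -/
noncomputable def multiplier (θ : ℝ) (φ : CSContactomorphism n) (p : H n) : ℂ :=
  (Real.sqrt (jac φ p) : ℂ) * Complex.exp (Complex.I * θ * (Real.log (jac φ p) : ℂ))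

theorem PiTheta_apply (θ : ℝ) (φ : CSContactomorphism n) (f : H n → ℂ) (p : H n) :
    PiTheta θ φ f p = f (φ.invFun p) * multiplier θ φ p := mul_assoc _ _ _

theorem norm_multiplier (θ : ℝ) (φ : CSContactomorphism n) (p : H n) :
    ‖multiplier θ φ p‖ = Real.sqrt (jac φ p) := by
  rw [multiplier, norm_mul, Complex.norm_exp]
  simp [abs_of_nonneg (Real.sqrt_nonneg _)]

theorem multiplier_ne_zero (θ : ℝ) (φ : CSContactomorphism n) (p : H n) :
    multiplier θ φ p ≠ 0 := by
  rw [← norm_pos_iff, norm_multiplier]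
  exact Real.sqrt_pos.2 (φ.jac_pos p)

theorem continuous_multiplier (θ : ℝ) (φ : CSContactomorphism n) :
    Continuous (multiplier θ φ) := by
  have h := φ.continuous_jac
  have hl : Continuous fun p => Real.log (jac φ p) := h.log fun p => (φ.jac_pos p).ne'
  unfold multiplier
  fun_prop

theorem memLp_PiTheta (θ : ℝ) (φ : CSContactomorphism n) {f : H n → ℂ}
    (hfm : StronglyMeasurable f) (hf : MemLp f 2) : MemLp (PiTheta θ φ f) 2 := by
  have hm : StronglyMeasurable (PiTheta θ φ f) := by
    have : PiTheta θ φ f = fun p => f (φ.invFun p) * multiplier θ φ p :=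
      funext (PiTheta_apply θ φ f)
    rw [this]
    exact (hfm.comp_measurable φ.smooth_inv.continuous.measurable).mul
      (continuous_multiplier θ φ).stronglyMeasurable
  rw [memLp_two_iff_integrable_sq_norm hm.aestronglyMeasurable]
  have h := φ.integrable_jac_smul_comp
    ((memLp_two_iff_integrable_sq_norm hfm.aestronglyMeasurable).1 hf)
  refine h.congr (Eventually.of_forall fun p => ?_)
  simp only [PiTheta_apply, norm_mul, norm_multiplier, mul_pow, Real.sq_sqrt (φ.jac_pos p).le,
    smul_eq_mul]
  ring

end Jacobian

section Conjugation

open scoped ContDiff RealInnerProductSpace Topology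
open Filter

variable {n : ℕ}

/-- Conjugation of a contactomorphism by the affine contact map `q ↦ L q + g`. -/
noncomputable def CSContactomorphism.conj (φ : CSContactomorphism n) (L : H n ≃L[ℝ] H n)
    (g : H n) (c : ℝ) (hc : c ≠ 0)
    (hL : ∀ q ζ, alpha0 (L q + g) (L ζ) = c * alpha0 q ζ) : CSContactomorphism n where
  toFun p := L (φ.toFun (L.symm (p - g))) + g
  invFun p := L (φ.invFun (L.symm (p - g))) + g
  left_inv p := by simp [φ.left_inv _]
  right_inv p := by simp [φ.right_inv _]
  smooth := (L.contDiff.comp (φ.smooth.comp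
    (L.symm.contDiff.comp (contDiff_id.sub contDiff_const)))).add contDiff_const
  smooth_inv := (L.contDiff.comp (φ.smooth_inv.comp
    (L.symm.contDiff.comp (contDiff_id.sub contDiff_const)))).add contDiff_const
  compactSupp := by
    have hK : IsCompact ((fun q => L q + g) '' closure {p | φ.toFun p ≠ p}) :=
      φ.compactSupp.image (L.continuous.add continuous_const)
    refine hK.of_isClosed_subset isClosed_closure (closure_minimal ?_ hK.isClosed)
    intro p hp
    refine ⟨L.symm (p - g), subset_closure fun h => hp ?_, by simp⟩
    rw [h]; simp
  contact p ζ hζ := by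
    have hq : L (L.symm (p - g)) + g = p := by simp
    have h1 : HasFDerivAt (fun p => L.symm (p - g)) (L.symm : H n →L[ℝ] H n) p :=
      L.symm.hasFDerivAt.comp p ((hasFDerivAt_id p).sub_const g)
    have h2 := (φ.smooth.differentiable (by simp) (L.symm (p - g))).hasFDerivAt
    have h3 := ((L.hasFDerivAt.comp p (h2.comp p h1)).add_const g).fderiv
    have h4 : fderiv ℝ (fun p => L (φ.toFun (L.symm (p - g))) + g) p ζ =
        L (fderiv ℝ φ.toFun (L.symm (p - g)) (L.symm ζ)) :=
      congrArg (fun M => M ζ) h3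
    rw [h4, hL, φ.contact, mul_zero]
    have h5 := hL (L.symm (p - g)) (L.symm ζ)
    rw [hq, L.apply_symm_apply, hζ] at h5
    exact (mul_eq_zero.1 h5.symm).resolve_left hc

theorem jac_conj (φ : CSContactomorphism n) (L : H n ≃L[ℝ] H n) (g : H n) (c : ℝ) (hc : c ≠ 0)
    (hL : ∀ q ζ, alpha0 (L q + g) (L ζ) = c * alpha0 q ζ) (q : H n) :
    jac (φ.conj L g c hc hL) (L q + g) = jac φ q := by
  have h1 : HasFDerivAt (fun p => L.symm (p - g)) (L.symm : H n →L[ℝ] H n) (L q + g) :=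
    L.symm.hasFDerivAt.comp _ ((hasFDerivAt_id _).sub_const g)
  have h2 := (φ.smooth_inv.differentiable (by simp) (L.symm (L q + g - g))).hasFDerivAt
  have h3 : fderiv ℝ (φ.conj L g c hc hL).invFun (L q + g) = _ :=
    ((L.hasFDerivAt.comp _ (h2.comp (L q + g) h1)).add_const g).fderiv
  rw [jac, h3, jac, add_sub_cancel_right, L.symm_apply_apply]
  congr 1
  exact LinearMap.det_conj (fderiv ℝ φ.invFun q : H n →ₗ[ℝ] H n) L.toLinearEquiv

theorem multiplier_conj (θ : ℝ) (φ : CSContactomorphism n) (L : H n ≃L[ℝ] H n) (g : H n) (c : ℝ)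
    (hc : c ≠ 0) (hL : ∀ q ζ, alpha0 (L q + g) (L ζ) = c * alpha0 q ζ) (q : H n) :
    multiplier θ (φ.conj L g c hc hL) (L q + g) = multiplier θ φ q := by
  rw [multiplier, multiplier, jac_conj]

theorem PiTheta_conj (θ : ℝ) (φ : CSContactomorphism n) (L : H n ≃L[ℝ] H n) (g : H n) (c : ℝ)
    (hc : c ≠ 0) (hL : ∀ q ζ, alpha0 (L q + g) (L ζ) = c * alpha0 q ζ) (f : H n → ℂ) (q : H n) :
    PiTheta θ (φ.conj L g c hc hL) f (L q + g) =
      f (L (φ.invFun q) + g) * multiplier θ φ q := by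
  rw [PiTheta_apply, multiplier_conj]
  simp [CSContactomorphism.conj]

/-- The anisotropic dilation `(x, y, z) ↦ (t x, t y, t² z)`. -/
def dilate (t : ℝ) (q : H n) : H n := (t • q.1, t • q.2.1, t ^ 2 * q.2.2)

theorem hmul_eq_inner (p q : H n) :
    hmul p q = (p.1 + q.1, p.2.1 + q.2.1, p.2.2 + q.2.2 + ⟪p.1, q.2.1⟫) := by
  simp [hmul, PiLp.inner_apply, mul_comm]

/-- The linear part of the affine contact map `q ↦ hmul (dilate t q) g`. -/
noncomputable def dilateShear (t : ℝ) (ht : t ≠ 0) (v : EuclideanSpace ℝ (Fin n)) :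
    H n ≃L[ℝ] H n :=
  LinearEquiv.toContinuousLinearEquiv
    { toFun := fun q => (t • q.1, t • q.2.1, t ^ 2 * q.2.2 + t * ⟪q.1, v⟫)
      invFun := fun q => (t⁻¹ • q.1, t⁻¹ • q.2.1, (t ^ 2)⁻¹ * (q.2.2 - ⟪q.1, v⟫))
      map_add' := fun p q => by
        ext1
        · simp
        · ext1
          · simp
          · simp [inner_add_left]; ring
      map_smul' := fun a q => by
        ext1
        · exact smul_comm t a q.1
        · ext1
          · exact smul_comm t a q.2.1
          · simp [real_inner_smul_left]; ring
      left_inv := fun q => by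
        ext1
        · simp [smul_smul, ht]
        · ext1
          · simp [smul_smul, ht]
          · simp [real_inner_smul_left, ht]
      right_inv := fun q => by
        ext1
        · simp [smul_smul, ht]
        · ext1
          · simp [smul_smul, ht]
          · simp [real_inner_smul_left, ht] }

theorem dilateShear_apply (t : ℝ) (ht : t ≠ 0) (v : EuclideanSpace ℝ (Fin n)) (q : H n) :
    dilateShear t ht v q = (t • q.1, t • q.2.1, t ^ 2 * q.2.2 + t * ⟪q.1, v⟫) := rfl

theorem dilateShear_add (t : ℝ) (ht : t ≠ 0) (q g : H n) :
    dilateShear t ht g.2.1 q + g = hmul (dilate t q) g := by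
  rw [hmul_eq_inner, dilateShear_apply]
  ext1
  · rfl
  · ext1
    · rfl
    · simp [dilate, real_inner_smul_left]; ring

theorem alpha0_dilateShear (t : ℝ) (ht : t ≠ 0) (g q ζ : H n) :
    alpha0 (dilateShear t ht g.2.1 q + g) (dilateShear t ht g.2.1 ζ) = t ^ 2 * alpha0 q ζ := by
  simp only [alpha0_eq_inner, dilateShear_apply, Prod.snd_add, Prod.fst_add, inner_add_left,
    real_inner_smul_left, real_inner_smul_right]
  rw [real_inner_comm g.2.1 ζ.1]
  ring

end Conjugation

section SmallNontrivial

open scoped ContDiff RealInnerProductSpace Topology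
open Filter

variable {n : ℕ}

theorem exists_jac_ne_one (n : ℕ) : ∃ (φ : CSContactomorphism n) (p : H n), jac φ p ≠ 1 := by
  obtain ⟨r, hr, h⟩ := exists_contactomorphism_eq_affineContact n
  have he0 : 0 < r / 2 := by positivity
  obtain ⟨φ, hφ⟩ := h 0 0 0 (r / 2) (by simpa) (by simpa) (by simpa)
    (by rw [abs_of_pos he0]; linarith)
  refine ⟨φ, φ.toFun 0, fun hj => ?_⟩
  set e := r / 2
  let Λ : H n →L[ℝ] H n := (ContinuousLinearMap.id ℝ _).prodMap
    (((1 + e) • ContinuousLinearMap.id ℝ _).prodMap ((1 + e) • ContinuousLinearMap.id ℝ ℝ))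
  have hloc : φ.toFun =ᶠ[𝓝 0] Λ := by
    have : ∀ᶠ p : H n in 𝓝 0, ‖p‖ < r :=
      continuous_norm.continuousAt.eventually_lt continuousAt_const (by simpa)
    filter_upwards [this] with p hp
    rw [hφ p hp]
    simp [affineContact, Λ]
    rfl
  have hd : fderiv ℝ φ.toFun 0 = Λ := by rw [hloc.fderiv_eq]; exact Λ.fderiv
  have hdet : Λ.det = (1 + e) ^ (n + 1) := by
    have : (Λ : H n →ₗ[ℝ] H n) = LinearMap.prodMap LinearMap.id (LinearMap.prodMap
      ((1 + e) • LinearMap.id) ((1 + e) • LinearMap.id)) := rfl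
    rw [ContinuousLinearMap.det, this, LinearMap.det_prodMap, LinearMap.det_prodMap]
    simp [LinearMap.det_smul, pow_succ]
  have hmul := φ.det_mul_det_inv (φ.toFun 0)
  rw [φ.left_inv, hd, hdet] at hmul
  have habs := congrArg abs hmul
  rw [abs_mul, abs_one] at habs
  rw [jac] at hj
  rw [hj, mul_one, abs_of_pos (by positivity)] at habs
  exact (one_lt_pow₀ (by linarith) (by simp)).ne' habs

namespace CSContactomorphism

/-- The closure of the set of points moved by `φ`. -/
def support (φ : CSContactomorphism n) : Set (H n) := closure {p | φ.toFun p ≠ p}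

theorem toFun_eq_self (φ : CSContactomorphism n) {p : H n} (hp : p ∉ φ.support) :
    φ.toFun p = p := by
  by_contra h
  exact hp (subset_closure h)

theorem invFun_eq_self (φ : CSContactomorphism n) {p : H n} (hp : p ∉ φ.support) :
    φ.invFun p = p := by
  conv_lhs => rw [← φ.toFun_eq_self hp]
  exact φ.left_inv p

theorem jac_eq_one (φ : CSContactomorphism n) {p : H n} (hp : p ∉ φ.support) : jac φ p = 1 := by
  have : φ.invFun =ᶠ[𝓝 p] id := by
    filter_upwards [isClosed_closure.isOpen_compl.mem_nhds hp] with q hq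
    exact φ.invFun_eq_self hq
  rw [jac, this.fderiv_eq, fderiv_id]
  simp [ContinuousLinearMap.det]

theorem image_invFun_support (φ : CSContactomorphism n) :
    φ.invFun '' φ.support = φ.support := by
  ext p
  constructor
  · rintro ⟨q, hq, rfl⟩
    by_contra h
    have := φ.toFun_eq_self h
    rw [φ.right_inv] at this
    rw [← this] at h
    exact h hq
  · intro hp
    refine ⟨φ.toFun p, ?_, φ.left_inv p⟩
    by_contra h
    have := φ.left_inv.injective (φ.toFun_eq_self h)
    rw [this] at h
    exact h hp

theorem setIntegral_jac (φ : CSContactomorphism n) :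
    ∫ p in φ.support, jac φ p = ∫ _ in φ.support, (1 : ℝ) := by
  have h := integral_image_eq_integral_abs_det_fderiv_smul volume
    (s := φ.support) isClosed_closure.measurableSet
    (fun x _ => (φ.smooth_inv.differentiable (by simp) x).hasFDerivAt.hasFDerivWithinAt)
    φ.right_inv.injective.injOn (fun _ => (1 : ℝ))
  rw [φ.image_invFun_support] at h
  rw [h]
  simp [jac]

end CSContactomorphism

theorem multiplier_eq_one (θ : ℝ) (φ : CSContactomorphism n) {p : H n} (hp : p ∉ φ.support) :
    multiplier θ φ p = 1 := by
  simp [multiplier, φ.jac_eq_one hp]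

/-- Strict Cauchy–Schwarz: the multiplier of a contactomorphism which does not preserve volume
has mean different from one. -/
theorem setIntegral_multiplier_sub_one_ne_zero (θ : ℝ) (φ : CSContactomorphism n) {p₀ : H n}
    (hp₀ : jac φ p₀ ≠ 1) : ∫ p in φ.support, (multiplier θ φ p - 1) ≠ 0 := by
  have hK : IsCompact φ.support := φ.compactSupp
  have hcont : ∀ {F : Type} [NormedAddCommGroup F] {u : H n → F}, Continuous u →
      IntegrableOn u φ.support := fun hu => hu.continuousOn.integrableOn_compact hK
  have hcs : Continuous fun p => Real.sqrt (jac φ p) := φ.continuous_jac.sqrt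
  have hpos : 0 < ∫ p in φ.support, (1 - Real.sqrt (jac φ p)) ^ 2 := by
    rw [setIntegral_eq_integral_of_forall_compl_eq_zero]
    · refine Continuous.integral_pos_of_hasCompactSupport_nonneg_nonzero (x := p₀)
        (by fun_prop) (HasCompactSupport.intro hK fun p hp => by simp [φ.jac_eq_one hp])
        (fun p => sq_nonneg _) ?_
      simp only [ne_eq, sq_eq_zero_iff, sub_eq_zero]
      intro h
      exact hp₀ (Real.sqrt_eq_one.1 h.symm)
    · intro p hp
      simp [φ.jac_eq_one hp]
  have hj : ∫ p in φ.support, (jac φ p - 1) = 0 := by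
    rw [integral_sub (hcont φ.continuous_jac) (hcont continuous_const), φ.setIntegral_jac, sub_self]
  have hsq : ∫ p in φ.support, (Real.sqrt (jac φ p) - 1) =
      -(1 / 2) * ∫ p in φ.support, (1 - Real.sqrt (jac φ p)) ^ 2 := by
    have : ∀ p, Real.sqrt (jac φ p) - 1 =
        1 / 2 * (jac φ p - 1) - 1 / 2 * (1 - Real.sqrt (jac φ p)) ^ 2 := fun p => by
      have := Real.sq_sqrt (φ.jac_pos p).le
      linear_combination (1 / 2) * this
    simp_rw [this]
    have h1 : IntegrableOn (fun p => 1 / 2 * (jac φ p - 1)) φ.support :=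
      hcont (continuous_const.mul (φ.continuous_jac.sub continuous_const))
    have h2 : IntegrableOn (fun p => 1 / 2 * (1 - Real.sqrt (jac φ p)) ^ 2) φ.support :=
      hcont (continuous_const.mul ((continuous_const.sub hcs).pow 2))
    rw [integral_sub h1 h2, integral_const_mul,
      integral_const_mul, hj]
    ring
  intro h0
  have hre : ∫ p in φ.support, (multiplier θ φ p - 1).re = 0 := by
    have h1 : IntegrableOn (fun p => multiplier θ φ p - 1) φ.support :=
      hcont ((continuous_multiplier θ φ).sub continuous_const)
    have := integral_re (𝕜 := ℂ) h1
    rw [h0] at this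
    simpa using this
  have hle : ∫ p in φ.support, (multiplier θ φ p - 1).re ≤
      ∫ p in φ.support, (Real.sqrt (jac φ p) - 1) := by
    refine integral_mono
      (hcont (Complex.continuous_re.comp ((continuous_multiplier θ φ).sub continuous_const)))
      (hcont (hcs.sub continuous_const)) fun p => ?_
    have := Complex.re_le_norm (multiplier θ φ p)
    rw [norm_multiplier] at this
    simpa using this
  rw [hre, hsq] at hle
  linarith

end SmallNontrivial

section Correlation

open scoped ContDiff RealInnerProductSpace Topology
open Filter

variable {n : ℕ}

theorem continuous_hmul : Continuous fun z : H n × H n => hmul z.1 z.2 := by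
  unfold hmul
  fun_prop

theorem zero_hmul (g : H n) : hmul 0 g = g := by
  simp [hmul]

theorem continuous_dilate : Continuous fun z : ℝ × H n => dilate z.1 z.2 := by
  unfold dilate
  fun_prop

theorem zero_dilate (q : H n) : dilate 0 q = 0 := by
  simp [dilate]

theorem measurePreserving_hmul (h : H n) : MeasurePreserving (hmul h) := by
  have h2 : MeasurePreserving (fun p : EuclideanSpace ℝ (Fin n) × ℝ =>
      (h.2.1 + p.1, h.2.2 + ⟪h.1, p.1⟫ + p.2)) :=
    (measurePreserving_add_left volume h.2.1).skew_product
      (g := fun a c => h.2.2 + ⟪h.1, a⟫ + c) (by fun_prop)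
      (Eventually.of_forall fun a => map_add_left_eq_self volume _)
  have h3 := (measurePreserving_add_left volume h.1).prod h2
  have : hmul h = Prod.map (fun x => h.1 + x) (fun p : EuclideanSpace ℝ (Fin n) × ℝ =>
      (h.2.1 + p.1, h.2.2 + ⟪h.1, p.1⟫ + p.2)) := by
    ext1 q
    rw [hmul_eq_inner]
    simp [Prod.map]
    ring
  rw [this]
  exact h3

/-- The pullback of an `L²` function under the left translation by `h`. -/
noncomputable def leftTranslate (f : Lp ℂ 2 (volume : Measure (H n))) (h : H n) :
    Lp ℂ 2 (volume : Measure (H n)) :=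
  Lp.compMeasurePreserving (hmul h) (measurePreserving_hmul h) f

theorem continuous_leftTranslate (f : Lp ℂ 2 (volume : Measure (H n))) :
    Continuous (leftTranslate f) := by
  let c : C(H n × H n, H n) := ⟨fun z => hmul z.1 z.2, continuous_hmul⟩
  exact Continuous.compMeasurePreservingLp (f := fun _ => f) (g := c.curry) continuous_const
    c.curry.continuous measurePreserving_hmul (by simp)

theorem norm_leftTranslate (f : Lp ℂ 2 (volume : Measure (H n))) (h : H n) :
    ‖leftTranslate f h‖ = ‖f‖ :=
  Lp.norm_compMeasurePreserving _ _

theorem leftTranslate_ae_eq (f : Lp ℂ 2 (volume : Measure (H n))) (h : H n) :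
    leftTranslate f h =ᵐ[volume] fun g => f (hmul h g) :=
  Lp.coeFn_compMeasurePreserving _ _

/-- The correlation over `s` of two left translated `L²` functions. -/
noncomputable def correlation (s : Set (H n)) (f k : Lp ℂ 2 (volume : Measure (H n)))
    (a b : H n) : ℂ :=
  ∫ g in s, f (hmul a g) * starRingEnd ℂ (k (hmul b g))

theorem correlation_eq_inner (s : Set (H n)) (f k : Lp ℂ 2 (volume : Measure (H n)))
    (a b : H n) : correlation s f k a b =
      inner ℂ (LpToLpRestrictCLM (H n) ℂ ℂ volume 2 s (leftTranslate k b))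
        (LpToLpRestrictCLM (H n) ℂ ℂ volume 2 s (leftTranslate f a)) := by
  rw [L2.inner_def]
  refine integral_congr_ae ?_
  filter_upwards [LpToLpRestrictCLM_coeFn ℂ s (leftTranslate k b),
    LpToLpRestrictCLM_coeFn ℂ s (leftTranslate f a),
    ae_restrict_of_ae (leftTranslate_ae_eq k b), ae_restrict_of_ae (leftTranslate_ae_eq f a)]
    with g h1 h2 h3 h4
  rw [h1, h2, h3, h4, RCLike.inner_apply]

theorem continuous_correlation (s : Set (H n)) (f k : Lp ℂ 2 (volume : Measure (H n))) :
    Continuous fun z : H n × H n => correlation s f k z.1 z.2 := by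
  simp_rw [correlation_eq_inner]
  exact ((ContinuousLinearMap.continuous _).comp
    ((continuous_leftTranslate k).comp continuous_snd)).inner
    ((ContinuousLinearMap.continuous _).comp ((continuous_leftTranslate f).comp continuous_fst))

theorem exists_norm_correlation_le (s : Set (H n)) (f k : Lp ℂ 2 (volume : Measure (H n))) :
    ∃ C, 0 ≤ C ∧ ∀ a b, ‖correlation s f k a b‖ ≤ C := by
  set R := LpToLpRestrictCLM (H n) ℂ ℂ volume 2 s
  refine ⟨‖R‖ * ‖k‖ * (‖R‖ * ‖f‖), by positivity, fun a b => ?_⟩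
  rw [correlation_eq_inner]
  refine (norm_inner_le_norm _ _).trans ?_
  rw [← norm_leftTranslate k b, ← norm_leftTranslate f a]
  gcongr
  · exact R.le_opNorm _
  · exact R.le_opNorm _

theorem memLp_comp_hmul (f : Lp ℂ 2 (volume : Measure (H n))) (K s : Set (H n))
    [IsFiniteMeasure (volume.restrict K)] {a : H n → H n} (ha : Continuous a) :
    MemLp (fun z : H n × H n => f (hmul (a z.1) z.2)) 2
      ((volume.restrict K).prod (volume.restrict s)) := by
  have h1 : MeasurePreserving (fun z : H n × H n => (z.1, hmul (a z.1) z.2))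
      ((volume.restrict K).prod volume) ((volume.restrict K).prod volume) :=
    (MeasurePreserving.id (volume.restrict K)).skew_product
      (g := fun q g => hmul (a q) g)
      (continuous_hmul.comp ((ha.comp continuous_fst).prodMk continuous_snd)).measurable
      (Eventually.of_forall fun q => (measurePreserving_hmul (a q)).map_eq)
  have h2 := ((Lp.memLp f).comp_snd (volume.restrict K)).comp_measurePreserving h1
  exact h2.mono_measure (Measure.prod_mono le_rfl Measure.restrict_le_self)

theorem integral_comp_add_eq_zero (L : H n ≃L[ℝ] H n) (g : H n) {F : H n → ℂ}
    (hF : ∫ p, F p = 0) : ∫ q, F (L q + g) = 0 := by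
  have h1 : ∫ p, F (p + g) = 0 := by rw [integral_add_right_eq_self, hF]
  have h2 := L.toHomeomorph.measurableEmbedding.integral_map (μ := volume) fun p => F (p + g)
  have h3 := Measure.map_linearMap_addHaar_eq_smul_addHaar (volume : Measure (H n))
    (f := (L : H n →ₗ[ℝ] H n)) (LinearEquiv.isUnit_det' L.toLinearEquiv).ne_zero
  have h4 : Measure.map L.toHomeomorph (volume : Measure (H n)) = _ := h3
  rw [h4, integral_smul_measure, h1, smul_zero] at h2
  exact h2.symm

theorem setIntegral_support_eq_zero (θ : ℝ) {f k : H n → ℂ}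
    (hz : ∀ ψ : CSContactomorphism n,
      ∫ p, (PiTheta θ ψ f p - f p) * starRingEnd ℂ (k p) = 0)
    (φ : CSContactomorphism n) {t : ℝ} (ht : t ≠ 0) (g : H n) :
    ∫ q in φ.support, (f (hmul (dilate t (φ.invFun q)) g) * multiplier θ φ q -
      f (hmul (dilate t q) g)) * starRingEnd ℂ (k (hmul (dilate t q) g)) = 0 := by
  have h := integral_comp_add_eq_zero (dilateShear t ht g.2.1) g
    (hz (φ.conj (dilateShear t ht g.2.1) g (t ^ 2) (pow_ne_zero 2 ht) (alpha0_dilateShear t ht g)))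
  simp_rw [PiTheta_conj, dilateShear_add] at h
  rw [setIntegral_eq_integral_of_forall_compl_eq_zero, h]
  intro q hq
  rw [φ.invFun_eq_self hq, multiplier_eq_one θ φ hq, mul_one, sub_self, zero_mul]

theorem setIntegral_correlation_eq_zero (θ : ℝ) {f k : Lp ℂ 2 (volume : Measure (H n))}
    (hz : ∀ ψ : CSContactomorphism n,
      ∫ p, (PiTheta θ ψ f p - f p) * starRingEnd ℂ (k p) = 0)
    (s : Set (H n)) (φ : CSContactomorphism n) {t : ℝ} (ht : t ≠ 0) :
    ∫ q in φ.support,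
      (multiplier θ φ q * correlation s f k (dilate t (φ.invFun q)) (dilate t q) -
        correlation s f k (dilate t q) (dilate t q)) = 0 := by
  have hK : IsCompact φ.support := φ.compactSupp
  have : IsFiniteMeasure (volume.restrict φ.support) := ⟨by simpa using hK.measure_lt_top⟩
  have hb : Continuous fun q : H n => dilate t q :=
    continuous_dilate.comp (continuous_const.prodMk continuous_id)
  have ha : Continuous fun q => dilate t (φ.invFun q) := hb.comp φ.smooth_inv.continuous
  have hk2 := (memLp_comp_hmul k φ.support s hb).star
  have h1 := (memLp_comp_hmul f φ.support s ha).integrable_mul hk2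
  have h2 := (memLp_comp_hmul f φ.support s hb).integrable_mul hk2
  obtain ⟨C, hC⟩ := hK.exists_bound_of_continuousOn (continuous_multiplier θ φ).continuousOn
  have h3 := h1.bdd_mul (c := C) (f := fun z : H n × H n => multiplier θ φ z.1)
    ((continuous_multiplier θ φ).comp continuous_fst).aestronglyMeasurable
    (by
      have : ∀ᵐ q ∂volume.restrict φ.support, ‖multiplier θ φ q‖ ≤ C :=
        (ae_restrict_iff' hK.measurableSet).2 (Eventually.of_forall hC)
      exact Measure.quasiMeasurePreserving_fst.ae this)
  have h4 := h3.sub h2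
  have hswap := integral_integral_swap
    (f := fun q g => (f (hmul (dilate t (φ.invFun q)) g) * multiplier θ φ q -
      f (hmul (dilate t q) g)) * starRingEnd ℂ (k (hmul (dilate t q) g)))
    (h4.congr (Eventually.of_forall fun z => by
      simp [Function.uncurry]; ring))
  simp_rw [setIntegral_support_eq_zero θ hz φ ht, integral_zero] at hswap
  rw [← hswap]
  refine integral_congr_ae (Eventually.of_forall fun q => ?_)
  have hm : ∀ (u : Lp ℂ 2 (volume : Measure (H n))) (c : H n),
      MemLp (fun g => u (hmul c g)) 2 (volume.restrict s) := fun u c =>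
    ((Lp.memLp u).comp_measurePreserving (measurePreserving_hmul c)).restrict s
  have hi : ∀ a b : H n, Integrable
      (fun g => f (hmul a g) * starRingEnd ℂ (k (hmul b g))) (volume.restrict s) :=
    fun a b => (hm f a).integrable_mul (hm k b).star
  simp only [correlation]
  rw [← integral_const_mul, ← integral_sub ((hi _ _).const_mul _) (hi _ _)]
  refine integral_congr_ae (Eventually.of_forall fun g => ?_)
  simp only
  ring

theorem setIntegral_mul_conj_eq_zero (θ : ℝ) {f k : Lp ℂ 2 (volume : Measure (H n))}
    (hz : ∀ ψ : CSContactomorphism n,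
      ∫ p, (PiTheta θ ψ f p - f p) * starRingEnd ℂ (k p) = 0) (s : Set (H n)) :
    ∫ p in s, f p * starRingEnd ℂ (k p) = 0 := by
  obtain ⟨φ, p₀, hp₀⟩ := exists_jac_ne_one n
  have hK : IsCompact φ.support := φ.compactSupp
  have hne := setIntegral_multiplier_sub_one_ne_zero θ φ hp₀
  have hm := continuous_multiplier θ φ
  have hΦ := continuous_correlation s f k
  have hinv := φ.smooth_inv.continuous
  have hd := continuous_dilate (n := n)
  obtain ⟨C, hC0, hC⟩ := exists_norm_correlation_le s f k
  let u : ℝ → H n → ℂ := fun t q =>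
    multiplier θ φ q * correlation s f k (dilate t (φ.invFun q)) (dilate t q) -
        correlation s f k (dilate t q) (dilate t q)
  have hu : Continuous fun z : ℝ × H n => u z.1 z.2 := by
    have ha : Continuous fun z : ℝ × H n => dilate z.1 (φ.invFun z.2) :=
      hd.comp (continuous_fst.prodMk (hinv.comp continuous_snd))
    exact ((hm.comp continuous_snd).mul (hΦ.comp (ha.prodMk hd))).sub (hΦ.comp (hd.prodMk hd))
  have hlim : Tendsto (fun j : ℕ => ∫ q in φ.support, u (1 / ((j : ℝ) + 1)) q) atTop
      (𝓝 (∫ q in φ.support, u 0 q)) := by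
    refine tendsto_integral_of_dominated_convergence
      (fun q => (‖multiplier θ φ q‖ + 1) * C) (fun j => ?_) ?_ (fun j => ?_) ?_
    · exact (hu.comp (continuous_const.prodMk continuous_id)).aestronglyMeasurable
    · exact ((hm.norm.add continuous_const).mul
        continuous_const).continuousOn.integrableOn_compact hK
    · refine Eventually.of_forall fun q => (norm_sub_le _ _).trans ?_
      rw [norm_mul, add_mul, one_mul]
      exact add_le_add (mul_le_mul_of_nonneg_left (hC _ _) (norm_nonneg _)) (hC _ _)
    · refine Eventually.of_forall fun q => ?_
      have hq : Continuous fun t : ℝ => (t, q) := by fun_prop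
      exact ((hu.comp hq).tendsto 0).comp tendsto_one_div_add_atTop_nhds_zero_nat
  have hzero : ∀ j : ℕ, ∫ q in φ.support, u (1 / ((j : ℝ) + 1)) q = 0 := fun j => by
    have hj : 1 / ((j : ℝ) + 1) ≠ 0 := by positivity
    exact setIntegral_correlation_eq_zero θ hz s φ hj
  simp_rw [hzero] at hlim
  have h0 := tendsto_nhds_unique hlim tendsto_const_nhds
  have h1 : ∀ q, u 0 q = (multiplier θ φ q - 1) * correlation s f k 0 0 := fun q => by
    simp only [u, zero_dilate]
    ring
  simp_rw [h1, integral_mul_const] at h0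
  have h2 := (mul_eq_zero.1 h0).resolve_left hne
  simpa only [correlation, zero_hmul] using h2

theorem ae_mul_conj_eq_zero (θ : ℝ) {f k : Lp ℂ 2 (volume : Measure (H n))}
    (hz : ∀ ψ : CSContactomorphism n,
      ∫ p, (PiTheta θ ψ f p - f p) * starRingEnd ℂ (k p) = 0) :
    ∀ᵐ p, f p * starRingEnd ℂ (k p) = 0 :=
  ((Lp.memLp f).integrable_mul (Lp.memLp k).star).ae_eq_zero_of_forall_setIntegral_eq_zero
    fun s _ _ => setIntegral_mul_conj_eq_zero θ hz s

end Correlation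

section Ergodicity

open scoped ContDiff RealInnerProductSpace Topology
open Filter

variable {n : ℕ}

/-- Every contactomorphism maps `A` to a set which is disjoint from `B` up to a null set. -/
def NeverMeets (A B : Set (H n)) : Prop :=
  ∀ φ : CSContactomorphism n, ∀ᵐ p, ¬(φ.invFun p ∈ A ∧ p ∈ B)

theorem NeverMeets.ae_toFun {A B : Set (H n)} (h : NeverMeets A B) (φ : CSContactomorphism n) :
    ∀ᵐ q, ¬(q ∈ A ∧ φ.toFun q ∈ B) := by
  have h1 : volume {p | φ.invFun p ∈ A ∧ p ∈ B} = 0 := by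
    simpa only [ae_iff, not_not] using h φ
  have h2 := addHaar_image_eq_zero_of_differentiableOn_of_addHaar_eq_zero volume
    (φ.smooth_inv.differentiable (by simp)).differentiableOn h1
  rw [ae_iff]
  refine measure_mono_null (fun q hq => ?_) h2
  simp only [not_not, Set.mem_ofPred_eq] at hq
  exact ⟨φ.toFun q, by simpa [φ.left_inv q] using hq, φ.left_inv q⟩

theorem norm_lt_of_norm_hmul_lt {r ρ : ℝ} (hρ : ρ ≤ 1) (hr : 4 * ρ < r) {q g : H n}
    (hq : ‖q‖ < ρ) (hp : ‖hmul q g‖ < ρ) : ‖g‖ < r := by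
  simp only [hmul_eq_inner, Prod.norm_def, max_lt_iff] at *
  obtain ⟨hq1, hq2, hq3⟩ := hq
  obtain ⟨hp1, hp2, hp3⟩ := hp
  have h1 : ‖g.1‖ < 2 * ρ := by
    have := norm_sub_le (q.1 + g.1) q.1
    rw [add_sub_cancel_left] at this
    linarith
  have h2 : ‖g.2.1‖ < 2 * ρ := by
    have := norm_sub_le (q.2.1 + g.2.1) q.2.1
    rw [add_sub_cancel_left] at this
    linarith
  have hi : |⟪q.1, g.2.1⟫| ≤ 2 * ρ := by
    refine (abs_real_inner_le_norm _ _).trans ?_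
    have h3 : ‖q.1‖ ≤ 1 := hq1.le.trans hρ
    nlinarith [norm_nonneg q.1, norm_nonneg g.2.1]
  rw [Real.norm_eq_abs, abs_lt] at *
  rw [abs_le] at hi
  have hρ0 : 0 < ρ := by linarith
  exact ⟨by linarith, by linarith, by linarith, by linarith⟩

theorem exists_ball_null (n : ℕ) : ∃ ρ > 0, ∀ A B : Set (H n), MeasurableSet A →
    MeasurableSet B → NeverMeets A B →
      volume (A ∩ Metric.ball 0 ρ) = 0 ∨ volume (B ∩ Metric.ball 0 ρ) = 0 := by
  obtain ⟨r, hr, h⟩ := exists_contactomorphism_eq_affineContact n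
  have hρ0 : 0 < min 1 (r / 5) := by positivity
  refine ⟨min 1 (r / 5), hρ0, fun A B hA hB hAB => ?_⟩
  set ρ := min 1 (r / 5)
  have hρ1 : ρ ≤ 1 := min_le_left _ _
  have hρr : ρ ≤ r / 5 := min_le_right _ _
  have hae : ∀ᵐ g : H n, ∀ᵐ q : H n, ¬((q ∈ A ∧ ‖q‖ < r) ∧ hmul q g ∈ B ∧ ‖g‖ < r) := by
    refine Eventually.of_forall fun g => ?_
    by_cases hg : ‖g‖ < r
    · obtain ⟨φ, hφ⟩ := h g.1 g.2.1 g.2.2 0 ((norm_fst_le g).trans_lt hg)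
        (((norm_fst_le g.2).trans (norm_snd_le g)).trans_lt hg)
        (((norm_snd_le g.2).trans (norm_snd_le g)).trans_lt hg) (by simpa)
      filter_upwards [hAB.ae_toFun φ] with q hq hq'
      refine hq ⟨hq'.1.1, ?_⟩
      have : affineContact g.1 g.2.1 g.2.2 0 q = hmul q g := by
        rw [hmul_eq_inner, affineContact, real_inner_comm]
        simp
        ring
      rw [hφ q hq'.1.2, this]
      exact hq'.2.1
    · exact Eventually.of_forall fun q hq => hg hq.2.2
  have hmeas : MeasurableSet {z : H n × H n |
      ¬((z.2 ∈ A ∧ ‖z.2‖ < r) ∧ hmul z.2 z.1 ∈ B ∧ ‖z.1‖ < r)} := by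
    have hc : Continuous fun z : H n × H n => hmul z.2 z.1 :=
      continuous_hmul.comp (continuous_snd.prodMk continuous_fst)
    exact (((measurable_snd hA).inter (measurableSet_lt measurable_snd.norm measurable_const)).inter
      ((hc.measurable hB).inter (measurableSet_lt measurable_fst.norm measurable_const))).compl
  rw [Measure.ae_ae_comm hmeas] at hae
  by_contra! hcon
  obtain ⟨q, ⟨hqA, hqρ⟩, hq⟩ := ((frequently_ae_mem_iff.2 hcon.1).and_eventually hae).exists
  rw [mem_ball_zero_iff] at hqρ
  refine hcon.2 ?_
  rw [← (measurePreserving_hmul q).measure_preimage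
    (hB.inter measurableSet_ball).nullMeasurableSet]
  refine measure_mono_null (fun g hg => ?_) (ae_iff.1 hq)
  simp only [Set.mem_preimage, Set.mem_inter_iff, mem_ball_zero_iff] at hg
  simp only [not_not, Set.mem_ofPred_eq]
  exact ⟨⟨hqA, by linarith⟩, hg.1, norm_lt_of_norm_hmul_lt hρ1 (by linarith) hqρ hg.2⟩

theorem volume_preimage_eq_zero_iff (L : H n ≃L[ℝ] H n) (s : Set (H n)) :
    volume (L ⁻¹' s) = 0 ↔ volume s = 0 := by
  rw [Measure.addHaar_preimage_continuousLinearEquiv]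
  have : (LinearMap.det (L.symm : H n →ₗ[ℝ] H n)) ≠ 0 :=
    (LinearEquiv.isUnit_det' L.symm.toLinearEquiv).ne_zero
  simpa using fun h => absurd h this

theorem NeverMeets.preimage {A B : Set (H n)} (h : NeverMeets A B) {t : ℝ} (ht : t ≠ 0) :
    NeverMeets (dilateShear t ht 0 ⁻¹' A) (dilateShear t ht 0 ⁻¹' B) := by
  intro φ
  have h1 := h (φ.conj (dilateShear t ht 0) 0 (t ^ 2) (pow_ne_zero 2 ht)
    (alpha0_dilateShear t ht 0))
  rw [ae_iff, ← volume_preimage_eq_zero_iff (dilateShear t ht 0)] at h1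
  simpa [ae_iff, CSContactomorphism.conj] using h1

theorem norm_lt_of_norm_dilateShear_lt {t ρ : ℝ} (ht : t ≠ 0) (ht1 : 1 ≤ t) {q : H n}
    (hq : ‖dilateShear t ht 0 q‖ < t * ρ) : ‖q‖ < ρ := by
  have ht0 : 0 < t := by linarith
  simp only [dilateShear_apply, Prod.norm_def, max_lt_iff, norm_smul, Real.norm_eq_abs,
    abs_of_pos ht0, inner_zero_right, mul_zero, add_zero, abs_mul, abs_pow] at *
  refine ⟨lt_of_mul_lt_mul_left hq.1 ht0.le, lt_of_mul_lt_mul_left hq.2.1 ht0.le, ?_⟩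
  have h1 : t * |q.2.2| ≤ t ^ 2 * |q.2.2| := by
    gcongr
    nlinarith
  exact lt_of_mul_lt_mul_left (h1.trans_lt hq.2.2) ht0.le

theorem NeverMeets.null_or_null {A B : Set (H n)} (h : NeverMeets A B) (hA : MeasurableSet A)
    (hB : MeasurableSet B) : volume A = 0 ∨ volume B = 0 := by
  obtain ⟨ρ, hρ, hnull⟩ := exists_ball_null n
  have hball : ∀ t : ℝ, 1 ≤ t →
      volume (A ∩ Metric.ball 0 (t * ρ)) = 0 ∨ volume (B ∩ Metric.ball 0 (t * ρ)) = 0 := by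
    intro t ht1
    have ht : t ≠ 0 := by linarith
    set D := dilateShear (n := n) t ht 0
    have hsub : ∀ C : Set (H n), volume (D ⁻¹' C ∩ Metric.ball 0 ρ) = 0 →
        volume (C ∩ Metric.ball 0 (t * ρ)) = 0 := fun C hC => by
      rw [← volume_preimage_eq_zero_iff D]
      have hqρ : ∀ q ∈ D ⁻¹' (C ∩ Metric.ball 0 (t * ρ)), q ∈ Metric.ball 0 ρ := fun q hq =>
        mem_ball_zero_iff.2
          (norm_lt_of_norm_dilateShear_lt ht ht1 (mem_ball_zero_iff.1 hq.2))
      exact measure_mono_null (fun q hq => Set.mem_inter hq.1 (hqρ q hq)) hC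
    exact (hnull _ _ (D.continuous.measurable hA) (D.continuous.measurable hB)
      (h.preimage ht)).imp (hsub A) (hsub B)
  have hex : ∀ C : Set (H n), volume C ≠ 0 →
      ∃ j : ℕ, volume (C ∩ Metric.ball 0 (((j : ℝ) + 1) * ρ)) ≠ 0 := by
    intro C hC
    by_contra! hj
    refine hC (measure_mono_null (fun p hp => ?_) (measure_iUnion_null hj))
    rw [Set.mem_iUnion]
    obtain ⟨j, hj⟩ := exists_nat_gt (‖p‖ / ρ)
    refine ⟨j, hp, ?_⟩
    rw [mem_ball_zero_iff]
    rw [div_lt_iff₀ hρ] at hj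
    linarith
  by_contra! hcon
  obtain ⟨i, hi⟩ := hex A hcon.1
  obtain ⟨j, hj⟩ := hex B hcon.2
  have hmono : ∀ (C : Set (H n)) (a : ℕ), a ≤ max i j →
      C ∩ Metric.ball 0 (((a : ℝ) + 1) * ρ) ⊆
        C ∩ Metric.ball 0 ((((max i j : ℕ) : ℝ) + 1) * ρ) := fun C a ha =>
    Set.inter_subset_inter_right _ (Metric.ball_subset_ball (by gcongr))
  rcases hball (((max i j : ℕ) : ℝ) + 1) (by simp) with h0 | h0
  · exact hi (measure_mono_null (hmono A i (le_max_left _ _)) h0)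
  · exact hj (measure_mono_null (hmono B j (le_max_right _ _)) h0)

end Ergodicity

/-- Irreducibility of the representation `Π^θ` of the group of compactly
supported contactomorphisms of `(ℝ²ⁿ⁺¹, ker α₀)` on `L²(ℝ²ⁿ⁺¹, λ)`: every
invariant closed subspace is trivial. -/
theorem contactomorphism_representation_irreducible
    (n : ℕ) (hn : 1 ≤ n) (θ : ℝ)
    (H₀ : Submodule ℂ (Lp ℂ 2 (volume : Measure (H n))))
    (hclosed : IsClosed (H₀ : Set (Lp ℂ 2 (volume : Measure (H n)))))
    (hinv : ∀ φ : CSContactomorphism n, ∀ f ∈ H₀,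
      ∀ g : Lp ℂ 2 (volume : Measure (H n)),
        (g : H n → ℂ) =ᵐ[volume] PiTheta θ φ (f : H n → ℂ) → g ∈ H₀) :
    H₀ = ⊥ ∨ H₀ = ⊤ := by
  by_contra! hcon
  obtain ⟨f, hf, hf0⟩ := H₀.ne_bot_iff.1 hcon.1
  have : CompleteSpace H₀ := hclosed.completeSpace_coe
  obtain ⟨k, hk, hk0⟩ := (Submodule.ne_bot_iff _).1
    (mt (Submodule.orthogonal_eq_bot_iff (K := H₀)).1 hcon.2)
  have hmem : ∀ (φ : CSContactomorphism n) (u : Lp ℂ 2 (volume : Measure (H n))), u ∈ H₀ →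
      ∃ v ∈ H₀, v =ᵐ[volume] PiTheta θ φ u := fun φ u hu =>
    have h := memLp_PiTheta θ φ (Lp.stronglyMeasurable u) (Lp.memLp u)
    ⟨h.toLp _, hinv φ u hu _ h.coeFn_toLp, h.coeFn_toLp⟩
  have hzero : ∀ u ∈ H₀, ∀ᵐ p, u p * starRingEnd ℂ (k p) = 0 := by
    refine fun u hu => ae_mul_conj_eq_zero θ fun ψ => ?_
    obtain ⟨v, hv, hvu⟩ := hmem ψ u hu
    have h := Submodule.inner_left_of_mem_orthogonal (H₀.sub_mem hv hu) hk
    rw [L2.inner_def] at h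
    rw [← h]
    refine integral_congr_ae ?_
    filter_upwards [hvu, Lp.coeFn_sub v u] with p h1 h2
    rw [h2, Pi.sub_apply, h1, RCLike.inner_apply]
  have hmeets : NeverMeets (n := n) {p | f p ≠ 0} {p | k p ≠ 0} := fun φ => by
    obtain ⟨v, hv, hvf⟩ := hmem φ f hf
    filter_upwards [hzero v hv, hvf] with p h1 h2 h3
    rw [h2, PiTheta_apply] at h1
    simp only [mul_eq_zero, map_eq_zero, multiplier_ne_zero, or_false] at h1
    exact h1.elim h3.1 h3.2
  have hsupp : ∀ u : Lp ℂ 2 (volume : Measure (H n)),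
      MeasurableSet {p | u p ≠ 0} := fun u =>
    (Lp.stronglyMeasurable u).measurable (measurableSet_singleton 0).compl
  rcases hmeets.null_or_null (hsupp f) (hsupp k) with h | h
  · exact hf0 (Lp.eq_zero_iff_ae_eq_zero.2 (ae_iff.2 h))
  · exact hk0 (Lp.eq_zero_iff_ae_eq_zero.2 (ae_iff.2 h))
end

section
/- Let f ∈ L¹(ℝ; ℂ) be compactly supported and suppose its Fourier transform 𝓕f vanishes at every point of the interval [−1, 1]. Then f = 0 almost everywhere. -/
open MeasureTheory
open scoped FourierTransform

/-- A function vanishes almost everywhere outside some compact set. -/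
def AECompactlySupported (f : ℝ → ℂ) : Prop :=
  ∃ K : Set ℝ, IsCompact K ∧ ∀ᵐ x ∂(volume), x ∉ K → f x = 0

open Filter Topology
open scoped ContDiff

/-- The complex Fourier integral of a compactly supported integrable function is entire. -/
theorem AECompactlySupported.differentiable_fourierIntegral {f : ℝ → ℂ}
    (hfc : AECompactlySupported f) (hf : Integrable f) :
    Differentiable ℂ fun z : ℂ ↦ ∫ x : ℝ, Complex.exp (-2 * Real.pi * Complex.I * x * z) * f x := by
  obtain ⟨K, hK, hfK⟩ := hfc
  obtain ⟨R, hR⟩ := hK.isBounded.exists_norm_le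
  have bound : ∀ᵐ x : ℝ, ∀ S : ℝ, ∀ z : ℂ, ‖z‖ ≤ S →
      ‖Complex.exp (-2 * Real.pi * Complex.I * x * z) * f x‖ ≤
        Real.exp (2 * Real.pi * R * S) * ‖f x‖ := by
    filter_upwards [hfK] with x hx S z hz
    by_cases hxK : x ∈ K
    · rw [norm_mul]
      gcongr
      refine (Complex.norm_exp_le_exp_norm _).trans (Real.exp_le_exp.2 ?_)
      have hxR := hR x hxK
      have hR₀ := (norm_nonneg x).trans hxR
      simp only [norm_mul, norm_neg, Complex.norm_ofNat, Complex.norm_real, Complex.norm_I,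
        mul_one, Real.norm_of_nonneg Real.pi_pos.le]
      gcongr
    · simp [hx hxK]
  have meas (z : ℂ) : AEStronglyMeasurable
      (fun x : ℝ ↦ Complex.exp (-2 * Real.pi * Complex.I * x * z) * f x) :=
    (by fun_prop : Continuous fun x : ℝ ↦
      Complex.exp (-2 * Real.pi * Complex.I * x * z)).aestronglyMeasurable.mul
        hf.aestronglyMeasurable
  intro z₀
  refine (hasDerivAt_integral_of_dominated_loc_of_deriv_le
    (F' := fun z x ↦ -2 * Real.pi * Complex.I * x *
      (Complex.exp (-2 * Real.pi * Complex.I * x * z) * f x))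
    (bound := fun x ↦ 2 * Real.pi * R * (Real.exp (2 * Real.pi * R * (‖z₀‖ + 1)) * ‖f x‖))
    (Metric.ball_mem_nhds z₀ one_pos) (.of_forall meas) ?_ ?_ ?_ ?_ ?_).2.differentiableAt
  · exact (hf.norm.const_mul _).mono' (meas z₀) (bound.mono fun x hx ↦ hx _ z₀ le_rfl)
  · exact (by fun_prop : Continuous fun x : ℝ ↦
      -2 * Real.pi * Complex.I * x).aestronglyMeasurable.mul (meas z₀)
  · filter_upwards [bound, hfK] with x hx hxf z hz
    by_cases hxK : x ∈ K
    · have hxR := hR x hxK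
      have hR₀ := (norm_nonneg x).trans hxR
      have hzS : ‖z‖ ≤ ‖z₀‖ + 1 := by
        have := norm_le_norm_add_norm_sub' z z₀
        have := mem_ball_iff_norm.1 hz
        linarith
      rw [norm_mul]
      refine mul_le_mul ?_ (hx _ z hzS) (norm_nonneg _) (by positivity)
      simp only [norm_mul, norm_neg, Complex.norm_ofNat, Complex.norm_real, Complex.norm_I,
        mul_one, Real.norm_of_nonneg Real.pi_pos.le]
      gcongr
    · simp [hxf hxK]
  · exact (hf.norm.const_mul _).const_mul _
  · refine .of_forall fun x z _ ↦ ?_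
    convert! (((hasDerivAt_id z).const_mul
      (-2 * Real.pi * Complex.I * x : ℂ)).cexp.mul_const (f x)) using 1
    simp only [id]
    ring

/-- An integrable function on `ℝ` with zero Fourier transform vanishes almost everywhere. -/
theorem MeasureTheory.Integrable.ae_eq_zero_of_fourier_eq_zero {f : ℝ → ℂ} (hf : Integrable f)
    (hF : 𝓕 f = 0) : f =ᵐ[volume] 0 := by
  refine ae_eq_zero_of_integral_contDiff_smul_eq_zero hf.locallyIntegrable fun g hg hgc ↦ ?_
  have hgc' : HasCompactSupport (Complex.ofRealCLM ∘ g) := hgc.comp_left rfl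
  have hg' : ContDiff ℝ ∞ (Complex.ofRealCLM ∘ g) := by fun_prop
  let φ : SchwartzMap ℝ ℂ := hgc'.toSchwartzMap hg'
  let ψ : SchwartzMap ℝ ℂ := 𝓕⁻ φ
  have hψ : 𝓕 ψ = φ := FourierTransform.fourier_fourierInv_eq φ
  have key : ∫ x, 𝓕 (⇑ψ) x • f x = ∫ x, ψ x • 𝓕 f x := by
    simpa using! VectorFourier.integral_fourierIntegral_smul_eq_flip (L := innerₗ ℝ)
      Real.continuous_fourierChar continuous_inner ψ.integrable hf
  rw [hF, ← SchwartzMap.fourier_coe, hψ] at key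
  simpa [φ] using key

/-- A compactly supported integrable function whose Fourier transform vanishes on
`[-1,1]` is zero almost everywhere. -/
theorem eq_zero_of_fourier_eq_zero_on_Icc (f : ℝ → ℂ) (hf : Integrable f)
    (hfc : AECompactlySupported f)
    (hF : ∀ ξ ∈ Set.Icc (-1 : ℝ) 1, 𝓕 f ξ = 0) :
    f =ᵐ[volume] 0 := by
  have fourier_eq (ξ : ℝ) :
      𝓕 f ξ = ∫ x : ℝ, Complex.exp (-2 * Real.pi * Complex.I * x * (ξ : ℂ)) * f x := by
    rw [Real.fourier_real_eq_integral_exp_smul]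
    congr with x
    rw [smul_eq_mul]
    push_cast
    ring_nf
  have hd := hfc.differentiable_fourierIntegral hf
  have hofReal : Tendsto ((↑) : ℝ → ℂ) (𝓝[≠] 0) (𝓝[≠] 0) := by
    simpa using Complex.continuous_ofReal.continuousAt.continuousWithinAt.tendsto_nhdsWithin
      (s := {0}ᶜ) (t := {0}ᶜ) (x := 0) fun x hx ↦ by simpa using hx
  have hzero : ∀ᶠ ξ : ℝ in 𝓝[≠] 0, 𝓕 f ξ = 0 :=
    nhdsWithin_le_nhds <| mem_of_superset (Icc_mem_nhds (by norm_num) one_pos) hF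
  have heq := AnalyticOnNhd.eq_of_frequently_eq (z₀ := 0)
    (fun z _ ↦ hd.analyticAt z) (fun z _ ↦ analyticAt_const (v := (0 : ℂ)))
    (hofReal.frequently (hzero.mono fun ξ hξ ↦ (fourier_eq ξ).symm.trans hξ).frequently)
  exact hf.ae_eq_zero_of_fourier_eq_zero <|
    funext fun ξ ↦ (fourier_eq ξ).trans (congrFun heq ξ)
end
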